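/- arXiv:1301.2061 — 2 statements merged into one kernel-verified Lean document; each statement's English description precedes it below -/
import Mathlib

section
/- Let μ be a compactly supported probability measure on ℝ with infinite support, and let f : ℝ → ℝ be bounded and continuous. Then for every ε > 0 there exists N ∈ ℕ such that for all n ≥ N the OPE of size n associated with μ satisfies P( |X_f^{(n)}/n − E[X_f^{(n)}]/n| ≥ ε ) ≤ 2·exp( − n ε/(6‖f‖_∞) ). -/
open MeasureTheory ProbabilityTheory Filter Topology

noncomputable section

/-- The squared Vandermonde determinant `∏_{i>j} (λ_i - λ_j)^2`. -/
def vandSq {n : ℕ} (l : Fin n → ℝ) : ℝ :=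
  ∏ q ∈ Finset.univ.filter (fun q : Fin n × Fin n => q.2 < q.1), (l q.1 - l q.2) ^ 2

/-- The orthogonal polynomial ensemble of size `n` associated with `μ`: the probability
measure on `ℝ^n` proportional to `∏_{i>j}(λ_i-λ_j)^2 dμ(λ_1)⋯dμ(λ_n)`. -/
def OPE (μ : Measure ℝ) (n : ℕ) : Measure (Fin n → ℝ) :=
  ((((Measure.pi fun _ : Fin n => μ).withDensity fun l => ENNReal.ofReal (vandSq l))
    Set.univ)⁻¹) •
    ((Measure.pi fun _ : Fin n => μ).withDensity fun l => ENNReal.ofReal (vandSq l))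

/-- The linear statistic `X_f = ∑ f(λ_j)`. -/
def linStat {n : ℕ} (f : ℝ → ℝ) (l : Fin n → ℝ) : ℝ := ∑ j, f (l j)

/-- The scaled linear statistic `X_{f,α,x*} = ∑ f(n^α (λ_j - x*))`. -/
def scaledLinStat {n : ℕ} (f : ℝ → ℝ) (α xs : ℝ) (l : Fin n → ℝ) : ℝ :=
  ∑ j, f ((n : ℝ) ^ α * (l j - xs))

/-- `p` is the family of orthonormal polynomials of `μ`: `p j` has degree `j`, positive
leading coefficient, and `∫ p_i p_j dμ = δ_{ij}`. -/
def IsOrthonormalPolys (μ : Measure ℝ) (p : ℕ → Polynomial ℝ) : Prop :=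
  (∀ j, (p j).degree = (j : WithBot ℕ)) ∧ (∀ j, 0 < (p j).leadingCoeff) ∧
    ∀ i j, ∫ x, (p i).eval x * (p j).eval x ∂μ = if i = j then 1 else 0

/-- All moments of `μ` are finite. -/
def HasAllMoments (μ : Measure ℝ) : Prop := ∀ k : ℕ, Integrable (fun x : ℝ => x ^ k) μ

/-- `μ` has infinite support: no finite set carries full `μ`-measure. -/
def InfiniteSupport (μ : Measure ℝ) : Prop := ∀ s : Finset ℝ, μ ((↑s : Set ℝ)ᶜ) ≠ 0

/-- The Christoffel–Darboux kernel `K_n(x,y) = ∑_{j<n} p_j(x) p_j(y)`. -/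
def CDKernel (p : ℕ → Polynomial ℝ) (n : ℕ) (x y : ℝ) : ℝ :=
  ∑ j ∈ Finset.range n, (p j).eval x * (p j).eval y

/-- The sup norm `‖f‖_∞` of a (bounded) function. -/
def supNorm (f : ℝ → ℝ) : ℝ := ⨆ x, |f x|

/-- The (topological) support of a measure on `ℝ`. -/
def measSupport (μ : Measure ℝ) : Set ℝ := {x | ∀ U ∈ 𝓝 x, μ U ≠ 0}

/-- The sine kernel `sin(πt)/(πt)` (equal to `1` at `t = 0`). -/
def sineKernel (t : ℝ) : ℝ := if t = 0 then 1 else Real.sin (Real.pi * t) / (Real.pi * t)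

/-- `K̃_n(x,y) = w(x)^{1/2} w(y)^{1/2} K_n(x,y)`, where `w` is the Radon–Nikodym
derivative of `μ` with respect to Lebesgue measure. -/
def tildeK (μ : Measure ℝ) (Kf : ℝ → ℝ → ℝ) (x y : ℝ) : ℝ :=
  Real.sqrt ((μ.rnDeriv volume x).toReal) * Real.sqrt ((μ.rnDeriv volume y).toReal) * Kf x y

/-- The Nevai condition at `x*` for a sequence of measures with kernels `Kf n`. -/
def NevaiCond (μ : ℕ → Measure ℝ) (Kf : ℕ → ℝ → ℝ → ℝ) (xs : ℝ) : Prop :=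
  ∀ f : ℝ → ℝ, Continuous f → HasCompactSupport f →
    Tendsto (fun n => ∫ y, (f y - f xs) * Kf n xs y ^ 2 / Kf n xs xs ∂(μ n)) atTop (𝓝 0)

/-- The `α`-Nevai condition at `x*` for a sequence of measures with kernels `Kf n`. -/
def AlphaNevaiCond (μ : ℕ → Measure ℝ) (Kf : ℕ → ℝ → ℝ → ℝ) (α xs : ℝ) : Prop :=
  ∀ f : ℝ → ℝ, Continuous f → HasCompactSupport f →
    ∀ S : Set ℝ, IsCompact S →
      TendstoUniformlyOn
        (fun n s => ∫ y, (f s - f ((n : ℝ) ^ α * (y - xs))) *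
            Kf n (xs + s / (n : ℝ) ^ α) y ^ 2 /
            Kf n (xs + s / (n : ℝ) ^ α) (xs + s / (n : ℝ) ^ α) ∂(μ n))
        (fun _ => 0) atTop S

open Matrix in
/-- **Andréief's identity** for the integral of a product of two determinants. -/
theorem andreief {ι α : Type*} [Fintype ι] [DecidableEq ι] [MeasurableSpace α]
    (μ : Measure α) [SigmaFinite μ] (φ ψ : ι → α → ℝ)
    (h : ∀ i j, Integrable (fun x => φ i x * ψ j x) μ) :
    Integrable (fun x : ι → α => (Matrix.of fun j i => φ i (x j)).det *
      (Matrix.of fun j i => ψ i (x j)).det) (Measure.pi fun _ => μ) ∧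
    ∫ x : ι → α, (Matrix.of fun j i => φ i (x j)).det * (Matrix.of fun j i => ψ i (x j)).det
      ∂(Measure.pi fun _ => μ) =
      (Fintype.card ι).factorial * (Matrix.of fun i j => ∫ x, φ i x * ψ j x ∂μ).det := by
  have key : (fun x : ι → α => (Matrix.of fun j i => φ i (x j)).det *
      (Matrix.of fun j i => ψ i (x j)).det) = fun x => ∑ σ : Equiv.Perm ι, ∑ τ : Equiv.Perm ι,
        (((Equiv.Perm.sign σ : ℤ) : ℝ) * ((Equiv.Perm.sign τ : ℤ) : ℝ)) *
          ∏ j, (φ (σ j) (x j) * ψ (τ j) (x j)) := by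
    ext x
    rw [← det_transpose, det_apply', ← det_transpose, det_apply', Finset.sum_mul_sum]
    refine Finset.sum_congr rfl fun σ _ => Finset.sum_congr rfl fun τ _ => ?_
    simp only [transpose_apply, of_apply, Finset.prod_mul_distrib]
    ring
  have hi (σ τ : Equiv.Perm ι) : Integrable (fun x : ι → α =>
      (((Equiv.Perm.sign σ : ℤ) : ℝ) * ((Equiv.Perm.sign τ : ℤ) : ℝ)) *
        ∏ j, (φ (σ j) (x j) * ψ (τ j) (x j))) (Measure.pi fun _ => μ) :=
    (Integrable.fintype_prod (f := fun j x => φ (σ j) x * ψ (τ j) x)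
      fun j => h (σ j) (τ j)).const_mul _
  rw [key]
  refine ⟨integrable_finsetSum _ fun σ _ => integrable_finsetSum _ fun τ _ => hi σ τ, ?_⟩
  rw [integral_finsetSum _ fun σ _ => integrable_finsetSum _ fun τ _ => hi σ τ]
  set G : Matrix ι ι ℝ := Matrix.of fun i j => ∫ x, φ i x * ψ j x ∂μ with hG
  have hσ (σ : Equiv.Perm ι) : ∫ x : ι → α, ∑ τ : Equiv.Perm ι,
        (((Equiv.Perm.sign σ : ℤ) : ℝ) * ((Equiv.Perm.sign τ : ℤ) : ℝ)) *
          ∏ j, (φ (σ j) (x j) * ψ (τ j) (x j)) ∂(Measure.pi fun _ => μ) = G.det := by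
    rw [integral_finsetSum _ fun τ _ => hi σ τ]
    have h1 : (G.submatrix σ id).det = ((Equiv.Perm.sign σ : ℤ) : ℝ) * G.det := det_permute σ G
    have h2 : ((Equiv.Perm.sign σ : ℤ) : ℝ) * ((Equiv.Perm.sign σ : ℤ) : ℝ) = 1 := by
      exact_mod_cast Int.units_coe_mul_self (Equiv.Perm.sign σ)
    calc _ = ((Equiv.Perm.sign σ : ℤ) : ℝ) * (G.submatrix σ id).det := by
          rw [← det_transpose, det_apply', Finset.mul_sum]
          refine Finset.sum_congr rfl fun τ _ => ?_
          rw [integral_const_mul,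
            integral_fintype_prod_eq_prod (fun j x => φ (σ j) x * ψ (τ j) x), mul_assoc]
          simp [hG]
      _ = G.det := by rw [h1, ← mul_assoc, h2, one_mul]
  rw [Finset.sum_congr rfl fun σ _ => hσ σ]
  simp [Finset.card_univ, Fintype.card_perm]

/-- If `diag(v) A = A F + R`, then `(∑ v - tr F) det A` is the sum of the determinants obtained by
replacing a column of `A` by the corresponding column of `R`. -/
theorem sum_mul_det_eq {ι : Type*} [Fintype ι] [DecidableEq ι] (A F R : Matrix ι ι ℝ)
    (v : ι → ℝ) (h : Matrix.diagonal v * A = A * F + R) :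
    (∑ j, v j - F.trace) * A.det = ∑ k, (A.updateCol k (fun j => R j k)).det := by
  have h1 : ∑ k, (A.updateCol k (fun j => R j k)).det = (A.adjugate * R).trace := by
    refine Finset.sum_congr rfl fun k _ => ?_
    rw [← Matrix.cramer_apply, Matrix.cramer_eq_adjugate_mulVec]
    rfl
  have h2 : (A.adjugate * (Matrix.diagonal v * A)).trace = A.det * ∑ j, v j := by
    rw [Matrix.trace_mul_comm, Matrix.mul_assoc, Matrix.mul_adjugate]
    simp [Matrix.trace, ← Finset.sum_mul, mul_comm]
  have h3 : (A.adjugate * (A * F)).trace = A.det * F.trace := by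
    rw [← Matrix.mul_assoc, Matrix.adjugate_mul]
    simp
  have h4 : R = Matrix.diagonal v * A - A * F := by rw [h]; abel
  rw [h1, h4, Matrix.mul_sub, Matrix.trace_sub, h2, h3]
  ring

open Polynomial in
theorem exists_orthonormal_polys (μ : Measure ℝ) (hinf : InfiniteSupport μ)
    (hint : ∀ g : ℝ → ℝ, Continuous g → Integrable g μ)
    (w : ℝ → ℝ) (hw : Continuous w) (hpos : ∀ x, 0 < w x) :
    ∃ e : ℕ → ℝ[X], (∀ i, (e i).natDegree ≤ i) ∧
      (∀ i j, ∫ x, (e i).eval x * (e j).eval x * w x ∂μ = if i = j then 1 else 0) ∧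
      ∀ (n : ℕ) (p : ℝ[X]), p.natDegree < n → ∃ a : Fin n → ℝ, p = ∑ i, a i • e i := by
  have hI (p q : ℝ[X]) : Integrable (fun x => p.eval x * q.eval x * w x) μ :=
    hint _ ((p.continuous.mul q.continuous).mul hw)
  let core : InnerProductSpace.Core ℝ ℝ[X] :=
    { inner := fun p q => ∫ x, p.eval x * q.eval x * w x ∂μ
      conj_inner_symm := fun p q => by
        simp only [conj_trivial]
        exact integral_congr_ae (Eventually.of_forall fun x => by ring)
      re_inner_nonneg := fun p => by
        simp only [RCLike.re_to_real]
        exact integral_nonneg fun x => mul_nonneg (mul_self_nonneg _) (hpos x).le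
      add_left := fun p q r => by
        rw [← integral_add (hI _ _) (hI _ _)]
        exact integral_congr_ae (Eventually.of_forall fun x => by simp only [eval_add]; ring)
      smul_left := fun p q r => by
        simp only [conj_trivial]
        rw [← integral_const_mul]
        exact integral_congr_ae (Eventually.of_forall fun x => by
          simp only [eval_smul, smul_eq_mul]; ring)
      definite := fun p hp => by
        by_contra hne
        have h0 := (integral_eq_zero_iff_of_nonneg
          (fun x => mul_nonneg (mul_self_nonneg _) (hpos x).le) (hI p p)).1 hp
        refine hinf p.roots.toFinset (measure_mono_null ?_ (ae_iff.1 h0))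
        intro x hx
        simp only [Set.mem_compl_iff, Finset.mem_coe, Multiset.mem_toFinset, mem_roots hne,
          IsRoot.def] at hx
        simp [hx, (hpos x).ne'] }
  let _ : NormedAddCommGroup ℝ[X] := core.toNormedAddCommGroup
  let _ : InnerProductSpace ℝ ℝ[X] := InnerProductSpace.ofCore core.toCore
  let m : ℕ → ℝ[X] := fun i => X ^ i
  have hm : LinearIndependent ℝ m := by
    have := (basisMonomials ℝ).linearIndependent
    convert this using 1
    ext1 i
    simp [m, X_pow_eq_monomial]
  let e := InnerProductSpace.gramSchmidtNormed ℝ m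
  have hspan (i : ℕ) : Submodule.span ℝ (e '' Set.Iic i) = Submodule.span ℝ (m '' Set.Iic i) := by
    rw [InnerProductSpace.span_gramSchmidtNormed, InnerProductSpace.span_gramSchmidt_Iic]
  refine ⟨e, fun i => ?_, fun i j => ?_, fun n p hp => ?_⟩
  · have h1 : e i ∈ Submodule.span ℝ (m '' Set.Iic i) := by
      rw [← hspan]
      exact Submodule.subset_span ⟨i, by simp, rfl⟩
    have h2 : Submodule.span ℝ (m '' Set.Iic i) ≤ degreeLE ℝ i := by
      rw [Submodule.span_le]
      rintro _ ⟨k, hk, rfl⟩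
      simp only [SetLike.mem_coe, mem_degreeLE]
      exact (degree_X_pow_le k).trans (by exact_mod_cast hk)
    exact natDegree_le_of_degree_le (mem_degreeLE.1 (h2 h1))
  · have := orthonormal_iff_ite.1 (InnerProductSpace.gramSchmidtNormed_orthonormal (𝕜 := ℝ) hm) i j
    exact this
  · have h1 : p ∈ Submodule.span ℝ (Set.range fun i : Fin n => e i) := by
      have h2 : Set.range (fun i : Fin n => e i) = e '' Set.Iic (n - 1) := by
        ext q
        constructor
        · rintro ⟨i, rfl⟩
          exact ⟨i, by simp only [Set.mem_Iic]; omega, rfl⟩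
        · rintro ⟨i, hi, rfl⟩
          simp only [Set.mem_Iic] at hi
          exact ⟨⟨i, by omega⟩, rfl⟩
      rw [h2, hspan, p.as_sum_range' n hp]
      refine Submodule.sum_mem _ fun i hi => ?_
      rw [← C_mul_X_pow_eq_monomial, ← smul_eq_C_mul]
      refine Submodule.smul_mem _ _ (Submodule.subset_span ⟨i, ?_, rfl⟩)
      simp only [Finset.mem_range, Set.mem_Iic] at *
      omega
    obtain ⟨a, ha⟩ := (Submodule.mem_span_range_iff_exists_fun ℝ).1 h1
    exact ⟨a, ha.symm⟩

theorem andreief_weighted {ι α : Type*} [Fintype ι] [DecidableEq ι] [MeasurableSpace α]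
    (μ : Measure α) [SigmaFinite μ] (w : α → ℝ) (φ ψ : ι → α → ℝ)
    (h : ∀ i j, Integrable (fun x => φ i x * ψ j x * w x) μ) :
    Integrable (fun x : ι → α => (Matrix.of fun j i => φ i (x j)).det *
      (Matrix.of fun j i => ψ i (x j)).det * ∏ j, w (x j)) (Measure.pi fun _ => μ) ∧
    ∫ x : ι → α, (Matrix.of fun j i => φ i (x j)).det * (Matrix.of fun j i => ψ i (x j)).det *
      ∏ j, w (x j) ∂(Measure.pi fun _ => μ) =
      (Fintype.card ι).factorial * (Matrix.of fun i j => ∫ x, φ i x * ψ j x * w x ∂μ).det := by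
  have key := andreief μ φ (fun i x => w x * ψ i x)
    fun i j => (h i j).congr (Eventually.of_forall fun x => by ring)
  have hdet (x : ι → α) : (Matrix.of fun j i => w (x j) * ψ i (x j)).det =
      (∏ j, w (x j)) * (Matrix.of fun j i => ψ i (x j)).det :=
    Matrix.det_mul_column (fun j => w (x j)) (Matrix.of fun j i => ψ i (x j))
  have h1 (x : ι → α) : (Matrix.of fun j i => φ i (x j)).det *
      (Matrix.of fun j i => w (x j) * ψ i (x j)).det = (Matrix.of fun j i => φ i (x j)).det *
      (Matrix.of fun j i => ψ i (x j)).det * ∏ j, w (x j) := by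
    rw [hdet]; ring
  have h2 (i j : ι) (x : α) : φ i x * (w x * ψ j x) = φ i x * ψ j x * w x := by ring
  simp only [h1, h2] at key
  exact key

theorem vandSq_eq_det_sq {n : ℕ} (l : Fin n → ℝ) : vandSq l = (Matrix.vandermonde l).det ^ 2 := by
  rw [Matrix.det_vandermonde, vandSq, Finset.prod_filter, Fintype.prod_prod_type_right,
    ← Finset.prod_pow]
  refine Finset.prod_congr rfl fun i _ => ?_
  rw [← Finset.prod_pow, ← Finset.prod_filter]
  refine Finset.prod_congr ?_ fun _ _ => rfl
  ext j
  simp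

theorem sum_ite_add_lt_le (n d : ℕ) (δ S : ℝ) :
    ∑ k : Fin n, (if (k : ℕ) + d < n then δ ^ 2 else S ^ 2) ≤ n * δ ^ 2 + d * S ^ 2 := by
  rw [Fin.sum_univ_eq_sum_range (fun k => if k + d < n then δ ^ 2 else S ^ 2), Finset.sum_ite]
  simp only [Finset.sum_const, nsmul_eq_mul]
  have h1 : ((Finset.range n).filter fun k => k + d < n).card ≤ n :=
    (Finset.card_filter_le _ _).trans (by simp)
  have h2 : ((Finset.range n).filter fun k => ¬ k + d < n).card ≤ d := by
    calc _ ≤ (Finset.Ico (n - d) n).card := by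
          refine Finset.card_le_card fun k hk => ?_
          simp only [Finset.mem_filter, Finset.mem_range, Finset.mem_Ico] at *
          omega
      _ ≤ d := by simp only [Nat.card_Ico]; omega
  gcongr

/-- The distance of `g` to the span of an orthonormal family is attained at the projection. -/
theorem integral_sub_projection_sq_le {ι : Type*} [Fintype ι] [DecidableEq ι] (μ : Measure ℝ)
    (hint : ∀ g : ℝ → ℝ, Continuous g → Integrable g μ)
    (w : ℝ → ℝ) (hw : Continuous w) (hpos : ∀ x, 0 < w x)
    (e : ι → ℝ → ℝ) (he : ∀ i, Continuous (e i))
    (r : ℝ → ℝ) (hr : Continuous r)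
    (horth : ∀ i, ∫ x, e i x * r x * w x ∂μ = 0) (b : ι → ℝ) :
    ∫ x, r x * r x * w x ∂μ ≤ ∫ x, (r x + ∑ i, b i * e i x) ^ 2 * w x ∂μ := by
  have h0 : ∫ x, ∑ i, 2 * b i * (e i x * r x * w x) ∂μ = 0 := by
    rw [integral_finsetSum _ fun i _ => hint _ (by have := he i; fun_prop)]
    simp [integral_const_mul, horth]
  calc ∫ x, r x * r x * w x ∂μ
      = ∫ x, (r x * r x * w x + ∑ i, 2 * b i * (e i x * r x * w x)) ∂μ := by
        rw [integral_add (hint _ (by fun_prop)) (hint _ (by fun_prop)), h0, add_zero]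
    _ ≤ _ := by
        refine integral_mono (hint _ (by fun_prop)) (hint _ (by fun_prop)) fun x => ?_
        have h1 : ∑ i, 2 * b i * (e i x * r x * w x) =
            2 * (∑ i, b i * e i x) * r x * w x := by
          simp only [Finset.mul_sum, Finset.sum_mul]
          exact Finset.sum_congr rfl fun i _ => by ring
        have h2 := mul_nonneg (sq_nonneg (∑ i, b i * e i x)) (hpos x).le
        simp only [h1]
        nlinarith

open Polynomial in
/-- Under the ensemble tilted by `∏ w(λ_j)`, the variance of `X_f` is at most `n δ² + deg(q) S²`
whenever the polynomial `q` is `δ`-close to `f` and `|f| ≤ S`. -/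
theorem weighted_variance_le (μ : Measure ℝ) [IsFiniteMeasure μ] (hinf : InfiniteSupport μ)
    (hint : ∀ g : ℝ → ℝ, Continuous g → Integrable g μ)
    (w : ℝ → ℝ) (hw : Continuous w) (hpos : ∀ x, 0 < w x)
    (f : ℝ → ℝ) (hf : Continuous f) (q : ℝ[X]) (δ S : ℝ)
    (hq : ∀ᵐ x ∂μ, |f x - q.eval x| ≤ δ) (hS : ∀ x, |f x| ≤ S) (n : ℕ) :
    Integrable (fun l : Fin n → ℝ => vandSq l * ∏ j, w (l j)) (Measure.pi fun _ => μ) ∧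
    0 < ∫ l : Fin n → ℝ, vandSq l * ∏ j, w (l j) ∂(Measure.pi fun _ => μ) ∧
    ∃ c : ℝ, ∫ l : Fin n → ℝ, (linStat f l - c) ^ 2 * (vandSq l * ∏ j, w (l j))
        ∂(Measure.pi fun _ => μ) ≤
      (n * δ ^ 2 + q.natDegree * S ^ 2) *
        ∫ l : Fin n → ℝ, vandSq l * ∏ j, w (l j) ∂(Measure.pi fun _ => μ) := by
  obtain ⟨p, hdeg, hon, hspan⟩ := exists_orthonormal_polys μ hinf hint w hw hpos
  let e : Fin n → ℝ → ℝ := fun i x => (p i).eval x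
  have he (i) : Continuous (e i) := (p i).continuous
  have hee (i j : Fin n) : ∫ x, e i x * e j x * w x ∂μ = if i = j then 1 else 0 := by
    simp only [e, hon, Fin.val_inj]
  let F : Matrix (Fin n) (Fin n) ℝ := Matrix.of fun i k => ∫ x, e i x * (f x * e k x) * w x ∂μ
  let r : Fin n → ℝ → ℝ := fun k x => f x * e k x - ∑ i, F i k * e i x
  have hr (k) : Continuous (r k) := by fun_prop
  have horth (i k : Fin n) : ∫ x, e i x * r k x * w x ∂μ = 0 := by
    have h1 (x : ℝ) : e i x * r k x * w x =
        e i x * (f x * e k x) * w x - ∑ m, F m k * (e i x * e m x * w x) := by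
      simp only [r, mul_sub, sub_mul, Finset.mul_sum, Finset.sum_mul]
      congr 1
      exact Finset.sum_congr rfl fun m _ => by ring
    simp only [h1]
    rw [integral_sub (hint _ (by fun_prop)) (hint _ (by fun_prop)),
      integral_finsetSum _ fun m _ => hint _ (by fun_prop)]
    simp [integral_const_mul, hee, F]
  have hrle (k : Fin n) (b : Fin n → ℝ) (s : ℝ)
      (hb : ∀ᵐ x ∂μ, (f x * e k x - ∑ i, b i * e i x) ^ 2 ≤ s ^ 2 * (e k x * e k x)) :
      ∫ x, r k x * r k x * w x ∂μ ≤ s ^ 2 := by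
    calc _ ≤ ∫ x, (r k x + ∑ i, (F i k - b i) * e i x) ^ 2 * w x ∂μ :=
          integral_sub_projection_sq_le μ hint w hw hpos e he (r k) (hr k) (horth · k) _
      _ ≤ ∫ x, s ^ 2 * (e k x * e k x * w x) ∂μ := by
          refine integral_mono_ae (hint _ (by fun_prop)) (hint _ (by fun_prop)) ?_
          filter_upwards [hb] with x hx
          have h1 : r k x + ∑ i, (F i k - b i) * e i x = f x * e k x - ∑ i, b i * e i x := by
            simp only [r, sub_mul, Finset.sum_sub_distrib]
            ring
          simp only [h1]
          calc _ ≤ s ^ 2 * (e k x * e k x) * w x :=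
                mul_le_mul_of_nonneg_right hx (hpos x).le
            _ = _ := by ring
      _ = s ^ 2 := by rw [integral_const_mul, hee]; simp
  have hsq (u v s : ℝ) (h : |u| ≤ s) : (u * v) ^ 2 ≤ s ^ 2 * (v * v) := by
    have := sq_le_sq' (abs_le.1 h).1 (abs_le.1 h).2
    nlinarith [mul_self_nonneg v]
  have hrk (k : Fin n) : ∫ x, r k x * r k x * w x ∂μ ≤
      if (k : ℕ) + q.natDegree < n then δ ^ 2 else S ^ 2 := by
    split_ifs with hk
    · obtain ⟨b, hb⟩ := hspan n (q * p k)
        (natDegree_mul_le.trans_lt (by have := hdeg k; omega))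
      refine hrle k b δ ?_
      filter_upwards [hq] with x hx
      have h1 := congrArg (eval x) hb
      simp only [eval_mul, eval_finsetSum, eval_smul, smul_eq_mul] at h1
      have h2 : f x * e k x - ∑ i, b i * e i x = (f x - q.eval x) * e k x := by
        simp only [e, ← h1]; ring
      rw [h2]
      exact hsq _ _ _ hx
    · refine hrle k 0 S (Eventually.of_forall fun x => ?_)
      simpa using hsq _ (e k x) _ (hS x)
  let A : (Fin n → ℝ) → Matrix (Fin n) (Fin n) ℝ := fun l => Matrix.of fun j i => e i (l j)
  let D : Fin n → (Fin n → ℝ) → ℝ := fun k l =>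
    (Matrix.of fun j i => Function.update e k (r k) i (l j)).det
  have hcont (k) (g : ℝ → ℝ) (hg : Continuous g) (i) : Continuous (Function.update e k g i) := by
    rcases eq_or_ne i k with rfl | h
    · simpa using hg
    · simpa [h] using he i
  have hid (l : Fin n → ℝ) : (linStat f l - F.trace) * (A l).det = ∑ k, D k l := by
    have h1 := sum_mul_det_eq (A l) F (Matrix.of fun j k => r k (l j)) (fun j => f (l j)) (by
      ext j k
      simp [A, r, Matrix.mul_apply, Matrix.diagonal_apply, mul_comm])
    rw [linStat, h1]
    refine Finset.sum_congr rfl fun k _ => ?_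
    simp only [D]
    congr 1
    ext j i
    rcases eq_or_ne i k with rfl | h
    · simp
    · simp [h, A]
  have hDD (k m : Fin n) := andreief_weighted μ w (Function.update e k (r k))
    (Function.update e m (r m)) fun i j => hint _
      (((hcont _ _ (hr k) i).mul (hcont _ _ (hr m) j)).mul hw)
  have hDint (k m : Fin n) : Integrable (fun l => D k l * D m l * ∏ j, w (l j))
      (Measure.pi fun _ => μ) := (hDD k m).1
  have hDDval (k m : Fin n) : ∫ l, D k l * D m l * ∏ j, w (l j) ∂(Measure.pi fun _ => μ) =
      if k = m then (n.factorial : ℝ) * ∫ x, r k x * r k x * w x ∂μ else 0 := by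
    rw [(hDD k m).2]
    split_ifs with hkm
    · subst hkm
      have h1 : (Matrix.of fun i j => ∫ x, Function.update e k (r k) i x *
          Function.update e k (r k) j x * w x ∂μ) = Matrix.diagonal
          (Function.update 1 k (∫ x, r k x * r k x * w x ∂μ)) := by
        ext i j
        rcases eq_or_ne i k with rfl | hi
        · rcases eq_or_ne j i with rfl | hj
          · simp
          · rw [Matrix.diagonal_apply_ne _ hj.symm]
            simpa [hj, mul_comm (r i _)] using horth j i
        · rcases eq_or_ne j k with rfl | hj
          · rw [Matrix.diagonal_apply_ne _ hi]
            simpa [hi] using horth i j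
          · simp [hi, hj, hee, Matrix.diagonal_apply]
      rw [h1, Matrix.det_diagonal, Fintype.card_fin, Finset.prod_update_of_mem (Finset.mem_univ k)]
      simp
    · rw [Matrix.det_eq_zero_of_row_eq_zero m, mul_zero]
      intro j
      rcases eq_or_ne j m with rfl | hj
      · simpa [Ne.symm hkm] using horth j j
      · simpa [Ne.symm hkm, hj] using (hee m j).trans (if_neg hj.symm)
  have hA := andreief_weighted μ w e e fun i j => hint _ (by fun_prop)
  have hAval : ∫ l, (A l).det * (A l).det * ∏ j, w (l j) ∂(Measure.pi fun _ => μ) =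
      n.factorial := by
    rw [hA.2]
    have h1 : (Matrix.of fun i j => ∫ x, e i x * e j x * w x ∂μ) = 1 := by
      ext i j
      simp [hee, Matrix.one_apply]
    simp [h1]
  set C : ℝ := (Matrix.of fun i j : Fin n => (p j).coeff i).det
  have hvand (l : Fin n → ℝ) : (A l).det * (A l).det * ∏ j, w (l j) =
      C ^ 2 * (vandSq l * ∏ j, w (l j)) := by
    have h1 : (A l).det = (Matrix.vandermonde l).det * C := by
      rw [← Matrix.det_mul, ← Matrix.eval_matrixOfPolynomials_eq_vandermonde_mul_matrixOfPolynomials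
        l (fun i : Fin n => p i) fun i => hdeg i]
    rw [h1, vandSq_eq_det_sq]
    ring
  have hZ : C ^ 2 * ∫ l : Fin n → ℝ, vandSq l * ∏ j, w (l j) ∂(Measure.pi fun _ => μ) =
      n.factorial := by
    rw [← hAval, ← integral_const_mul]
    exact integral_congr_ae (Eventually.of_forall fun l => (hvand l).symm)
  have hfac : (0 : ℝ) < n.factorial := by positivity
  have hC : 0 < C ^ 2 := by
    refine (sq_nonneg C).lt_of_ne fun h => ?_
    rw [← h, zero_mul] at hZ
    exact hfac.ne hZ
  refine ⟨?_, ?_, F.trace, ?_⟩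
  · have h1 := hA.1.const_mul (C ^ 2)⁻¹
    refine h1.congr (Eventually.of_forall fun l => ?_)
    have h2 := hvand l
    simp only [A] at h2
    simp only [h2, inv_mul_cancel_left₀ hC.ne']
  · exact pos_of_mul_pos_right (hZ ▸ hfac) hC.le
  · refine le_of_mul_le_mul_left ?_ hC
    calc C ^ 2 * ∫ l : Fin n → ℝ, (linStat f l - F.trace) ^ 2 * (vandSq l * ∏ j, w (l j))
          ∂(Measure.pi fun _ => μ)
        = ∫ l, ∑ k, ∑ m, D k l * D m l * ∏ j, w (l j) ∂(Measure.pi fun _ => μ) := by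
          rw [← integral_const_mul]
          refine integral_congr_ae (Eventually.of_forall fun l => ?_)
          have h1 : ∑ k, ∑ m, D k l * D m l * ∏ j, w (l j) =
              (∑ k, D k l) * (∑ m, D m l) * ∏ j, w (l j) := by
            rw [Finset.sum_mul_sum]
            simp only [Finset.sum_mul]
          beta_reduce
          rw [h1, mul_left_comm, ← hvand, ← hid]
          ring
      _ = ∑ k, (n.factorial : ℝ) * ∫ x, r k x * r k x * w x ∂μ := by
          rw [integral_finsetSum _ fun k _ => integrable_finsetSum _ fun m _ => hDint k m]
          refine Finset.sum_congr rfl fun k _ => ?_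
          rw [integral_finsetSum _ fun m _ => hDint k m]
          simp [hDDval]
      _ ≤ (n.factorial : ℝ) * (n * δ ^ 2 + q.natDegree * S ^ 2) := by
          rw [← Finset.mul_sum]
          gcongr
          exact (Finset.sum_le_sum fun k _ => hrk k).trans (sum_ite_add_lt_le _ _ _ _)
      _ = _ := by rw [← hZ]; ring

/-- A bound on the variance under all exponential tilts bounds the moment generating function. -/
theorem mgf_le_of_tilted_variance_le {Ω : Type*} [MeasurableSpace Ω] {P : Measure Ω}
    [IsProbabilityMeasure P] {Y : Ω → ℝ} {V : ℝ} (hm : Measurable Y)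
    (hi : ∀ u : ℝ, Integrable (fun ω => Real.exp (u * Y ω)) P) (hc : ∫ ω, Y ω ∂P = 0)
    (hV : ∀ u : ℝ, ∃ c : ℝ, ∫ ω, (Y ω - c) ^ 2 * Real.exp (u * Y ω) ∂P ≤
      V * ∫ ω, Real.exp (u * Y ω) ∂P) {t : ℝ} (ht : 0 < t) :
    mgf Y P t ≤ Real.exp (V * t ^ 2 / 2) := by
  have hs : Set.Icc 0 t ⊆ interior (integrableExpSet Y P) := by simp [hi, integrableExpSet]
  obtain ⟨u, h1, h2⟩ := exists_cgf_eq_iteratedDeriv_two_cgf_mul ht hc hs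
  rw [← exp_cgf (hi t), Real.exp_le_exp, h2]
  gcongr
  have := isProbabilityMeasure_tilted (hi u)
  obtain ⟨c, hle⟩ := hV u
  have hpos : 0 < ∫ ω, Real.exp (u * Y ω) ∂P := integral_exp_pos (hi u)
  calc _ = Var[Y; P.tilted (u * Y ·)] := by
        rw [← variance_tilted_mul (hs (Set.mem_Icc_of_Ioo h1))]
    _ = Var[fun ω => Y ω - c; P.tilted (u * Y ·)] :=
        (variance_sub_const hm.aestronglyMeasurable c).symm
    _ ≤ ∫ ω, (Y ω - c) ^ 2 ∂(P.tilted (u * Y ·)) :=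
        variance_le_expectation_sq (hm.sub_const c).aestronglyMeasurable
    _ = (∫ ω, (Y ω - c) ^ 2 * Real.exp (u * Y ω) ∂P) / ∫ ω, Real.exp (u * Y ω) ∂P := by
        rw [integral_tilted, ← integral_div]
        refine integral_congr_ae (Eventually.of_forall fun ω => ?_)
        simp only [smul_eq_mul]
        ring
    _ ≤ V := (div_le_iff₀ hpos).2 hle

theorem hasSubgaussianMGF_of_tilted_variance_le {Ω : Type*} [MeasurableSpace Ω] {P : Measure Ω}
    [IsProbabilityMeasure P] {X : Ω → ℝ} {B : ℝ} {V : NNReal} (hm : Measurable X)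
    (hB : ∀ ω, |X ω| ≤ B)
    (hV : ∀ u : ℝ, ∃ c : ℝ, ∫ ω, (X ω - c) ^ 2 * Real.exp (u * X ω) ∂P ≤
      V * ∫ ω, Real.exp (u * X ω) ∂P) :
    HasSubgaussianMGF (fun ω => X ω - ∫ ω', X ω' ∂P) V P := by
  set m := ∫ ω, X ω ∂P with hmdef
  have hX : Integrable X P := Integrable.of_mem_Icc (-B) B hm.aemeasurable
    (Eventually.of_forall fun ω => abs_le.1 (hB ω))
  have hi (u : ℝ) : Integrable (fun ω => Real.exp (u * (X ω - m))) P :=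
    integrable_exp_mul_of_mem_Icc (a := -B - m) (b := B - m) (hm.sub_const m).aemeasurable
      (Eventually.of_forall fun ω =>
        ⟨sub_le_sub_right (abs_le.1 (hB ω)).1 m, sub_le_sub_right (abs_le.1 (hB ω)).2 m⟩)
  have hc : ∫ ω, (X ω - m) ∂P = 0 := by
    rw [integral_sub hX (integrable_const _)]
    simp [hmdef]
  have hV' (u : ℝ) : ∃ c : ℝ, ∫ ω, (X ω - m - c) ^ 2 * Real.exp (u * (X ω - m)) ∂P ≤
      V * ∫ ω, Real.exp (u * (X ω - m)) ∂P := by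
    obtain ⟨c, h⟩ := hV u
    refine ⟨c - m, ?_⟩
    have h1 (ω : Ω) : Real.exp (u * (X ω - m)) = Real.exp (-(u * m)) * Real.exp (u * X ω) := by
      rw [← Real.exp_add]
      ring_nf
    have h2 (ω : Ω) : (X ω - m - (c - m)) ^ 2 * (Real.exp (-(u * m)) * Real.exp (u * X ω)) =
        Real.exp (-(u * m)) * ((X ω - c) ^ 2 * Real.exp (u * X ω)) := by ring
    simp only [h1, h2, integral_const_mul]
    rw [mul_left_comm]
    gcongr
  refine ⟨hi, fun t => ?_⟩
  obtain ht | rfl | ht := lt_trichotomy 0 t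
  · exact mgf_le_of_tilted_variance_le (hm.sub_const m) hi hc hV' ht
  · simp
  · have h1 : mgf (fun ω => X ω - m) P t = mgf (fun ω => -(X ω - m)) P (-t) := by
      simp only [mgf, neg_mul_neg]
    have hm' : Measurable fun ω => -(X ω - m) := (hm.sub_const m).neg
    rw [h1, ← neg_sq t]
    refine mgf_le_of_tilted_variance_le hm' (fun u => ?_) ?_ (fun u => ?_)
      (neg_pos.2 ht)
    · simpa only [mul_neg, neg_mul] using hi (-u)
    · rw [integral_neg, hc, neg_zero]
    · obtain ⟨c, h⟩ := hV' (-u)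
      refine ⟨-c, ?_⟩
      have h2 (ω : Ω) : (-(X ω - m) - -c) ^ 2 = (X ω - m - c) ^ 2 := by ring
      simpa only [h2, mul_neg, neg_mul] using h

theorem measurable_vandSq {n : ℕ} : Measurable (vandSq : (Fin n → ℝ) → ℝ) := by
  unfold vandSq
  fun_prop

theorem vandSq_nonneg {n : ℕ} (l : Fin n → ℝ) : 0 ≤ vandSq l :=
  Finset.prod_nonneg fun _ _ => sq_nonneg _

/-- Integrals against the ensemble are normalised integrals against the product measure. -/
theorem isProbabilityMeasure_OPE_and_integral (μ : Measure ℝ) [IsFiniteMeasure μ] (n : ℕ)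
    (hi : Integrable (fun l : Fin n → ℝ => vandSq l) (Measure.pi fun _ => μ))
    (hpos : 0 < ∫ l : Fin n → ℝ, vandSq l ∂(Measure.pi fun _ => μ)) :
    IsProbabilityMeasure (OPE μ n) ∧ ∀ g : (Fin n → ℝ) → ℝ, ∫ l, g l ∂(OPE μ n) =
      (∫ l : Fin n → ℝ, vandSq l ∂(Measure.pi fun _ => μ))⁻¹ *
        ∫ l, g l * vandSq l ∂(Measure.pi fun _ => μ) := by
  have hZ : ((Measure.pi fun _ : Fin n => μ).withDensity fun l => ENNReal.ofReal (vandSq l))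
      Set.univ = ENNReal.ofReal (∫ l : Fin n → ℝ, vandSq l ∂(Measure.pi fun _ => μ)) := by
    rw [withDensity_apply _ MeasurableSet.univ, Measure.restrict_univ,
      ofReal_integral_eq_lintegral_ofReal hi (Eventually.of_forall vandSq_nonneg)]
  refine ⟨⟨?_⟩, fun g => ?_⟩
  · rw [OPE, Measure.smul_apply, smul_eq_mul, hZ]
    exact ENNReal.inv_mul_cancel (by simpa using hpos) ENNReal.ofReal_ne_top
  · rw [OPE, integral_smul_measure, hZ, integral_withDensity_eq_integral_toReal_smul
      measurable_vandSq.ennreal_ofReal (by simp), ENNReal.toReal_inv,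
      ENNReal.toReal_ofReal hpos.le, smul_eq_mul]
    simp only [ENNReal.toReal_ofReal (vandSq_nonneg _), smul_eq_mul, mul_comm]

/-- Centred linear statistics are sub-Gaussian with the variance proxy given by polynomial
approximation of the test function. -/
theorem hasSubgaussianMGF_linStat (μ : Measure ℝ) [IsFiniteMeasure μ] (hinf : InfiniteSupport μ)
    (hint : ∀ g : ℝ → ℝ, Continuous g → Integrable g μ)
    (f : ℝ → ℝ) (hf : Continuous f) (q : Polynomial ℝ) (δ S : ℝ)
    (hq : ∀ᵐ x ∂μ, |f x - q.eval x| ≤ δ) (hS : ∀ x, |f x| ≤ S) (n : ℕ) :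
    IsProbabilityMeasure (OPE μ n) ∧
    HasSubgaussianMGF (fun l => linStat f l - ∫ l', linStat f l' ∂(OPE μ n))
      (n * δ ^ 2 + q.natDegree * S ^ 2).toNNReal (OPE μ n) := by
  obtain ⟨hi, hpos, -⟩ := weighted_variance_le μ hinf hint (fun _ => 1) continuous_const
    (fun _ => one_pos) f hf q δ S hq hS n
  simp only [Finset.prod_const_one, mul_one] at hi hpos
  obtain ⟨hP, hOPE⟩ := isProbabilityMeasure_OPE_and_integral μ n hi hpos
  refine ⟨hP, hasSubgaussianMGF_of_tilted_variance_le (B := n * S) ?_ (fun l => ?_) fun u => ?_⟩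
  · have := hf.measurable
    unfold linStat
    fun_prop
  · exact (Finset.abs_sum_le_sum_abs _ _).trans
      ((Finset.sum_le_sum fun j _ => hS (l j)).trans (by simp))
  · obtain ⟨-, -, c, hc⟩ := weighted_variance_le μ hinf hint (fun x => Real.exp (u * f x))
      (by fun_prop) (fun _ => Real.exp_pos _) f hf q δ S hq hS n
    have hw (l : Fin n → ℝ) : ∏ j, Real.exp (u * f (l j)) = Real.exp (u * linStat f l) := by
      rw [← Real.exp_sum, linStat, Finset.mul_sum]
    refine ⟨c, ?_⟩
    rw [hOPE, hOPE, Real.coe_toNNReal _ (by positivity), mul_left_comm]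
    refine mul_le_mul_of_nonneg_left ?_ (inv_nonneg.2 hpos.le)
    simpa only [hw, mul_assoc, mul_comm (vandSq _)] using hc

/-- **Improved global concentration for continuous `f`** (Theorem 4.5(II)): for a
compactly supported probability measure `μ` on `ℝ` with infinite support and bounded
continuous `f`, for every `ε > 0` and all sufficiently large `n`,
`P(|X_f/n - E[X_f]/n| ≥ ε) ≤ 2 exp(-nε/(6‖f‖_∞))`. -/
theorem global_concentration_continuous
    (μ : Measure ℝ) (hprob : IsProbabilityMeasure μ)
    (hinf : InfiniteSupport μ)
    (hcs : ∃ K : Set ℝ, IsCompact K ∧ μ Kᶜ = 0)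
    (f : ℝ → ℝ) (hf : Continuous f) (hfb : ∃ C : ℝ, ∀ x, |f x| ≤ C) :
    ∀ ε : ℝ, 0 < ε → ∃ N : ℕ, ∀ n : ℕ, N ≤ n →
      (OPE μ n) {l | ε ≤ |linStat f l / n - (∫ l, linStat f l ∂(OPE μ n)) / n|} ≤
        ENNReal.ofReal (2 * Real.exp (-((n : ℝ) * ε / (6 * supNorm f)))) := by
  obtain ⟨K, hK, hKμ⟩ := hcs
  obtain ⟨B, hB⟩ := hK.isBounded.subset_closedBall 0
  have hae : ∀ᵐ x ∂μ, x ∈ Set.Icc (-B) B := by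
    filter_upwards [mem_ae_iff.2 hKμ] with x hxK
    simpa [Real.closedBall_eq_Icc] using hB hxK
  have hint (g : ℝ → ℝ) (hg : Continuous g) : Integrable g μ := by
    rw [← Measure.restrict_eq_self_of_ae_mem hae]
    exact hg.continuousOn.integrableOn_compact isCompact_Icc
  set S := supNorm f with hSdef
  have hS (x : ℝ) : |f x| ≤ S :=
    le_ciSup (f := fun x => |f x|) (let ⟨C, hC⟩ := hfb; ⟨C, by rintro _ ⟨x, rfl⟩; exact hC x⟩) x
  intro ε hε
  rcases ((abs_nonneg _).trans (hS 0)).eq_or_lt with hS0 | hS0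
  · refine ⟨0, fun n _ => ?_⟩
    have := (hasSubgaussianMGF_linStat μ hinf hint f hf 0 S S
      (by simpa using Eventually.of_forall hS) hS n).1
    refine prob_le_one.trans ?_
    simp [← hS0]
  obtain ⟨q, hq⟩ := exists_polynomial_near_of_continuousOn (-B) B f hf.continuousOn
    (Real.sqrt (S * ε)) (by positivity)
  have hqae : ∀ᵐ x ∂μ, |f x - q.eval x| ≤ Real.sqrt (S * ε) := by
    filter_upwards [hae] with x hx
    rw [abs_sub_comm]
    exact (hq x hx).le
  obtain ⟨N, hN⟩ := exists_nat_ge (q.natDegree * S / (2 * ε))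
  refine ⟨N + 1, fun n hn => ?_⟩
  have hnN : (N : ℝ) + 1 ≤ n := by exact_mod_cast hn
  have hn0 : (0 : ℝ) < n := by linarith [Nat.cast_nonneg (α := ℝ) N]
  obtain ⟨hP, hsub⟩ := hasSubgaussianMGF_linStat μ hinf hint f hf q _ S hqae hS n
  set V := (n * Real.sqrt (S * ε) ^ 2 + q.natDegree * S ^ 2).toNNReal with hVdef
  have hV : (V : ℝ) = n * (S * ε) + q.natDegree * S ^ 2 := by
    rw [hVdef, Real.coe_toNNReal _ (by positivity), Real.sq_sqrt (by positivity)]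
  have hVpos : 0 < (V : ℝ) := by rw [hV]; positivity
  have hVle : (V : ℝ) ≤ 3 * S * ε * n := by
    rw [div_le_iff₀ (by positivity)] at hN
    rw [hV]
    nlinarith [mul_le_mul_of_nonneg_left hN hS0.le, mul_pos (mul_pos hS0 hε) hn0,
      mul_pos hS0 hε]
  have hexp : Real.exp (-(n * ε) ^ 2 / (2 * V)) ≤ Real.exp (-(n * ε / (6 * S))) := by
    rw [Real.exp_le_exp, neg_div, neg_le_neg_iff, div_le_div_iff₀ (by positivity) (by positivity)]
    nlinarith [mul_le_mul_of_nonneg_left hVle (mul_pos hn0 hε).le]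
  have hnε : 0 ≤ n * ε := by positivity
  set m := ∫ l, linStat f l ∂(OPE μ n)
  have hsubset : {l : Fin n → ℝ | ε ≤ |linStat f l / n - m / n|} ⊆
      {l | n * ε ≤ linStat f l - m} ∪ {l | n * ε ≤ -(linStat f l - m)} := by
    intro l hl
    simp only [Set.mem_ofPred_eq] at hl
    rw [← sub_div, abs_div, abs_of_pos hn0, le_div_iff₀ hn0, mul_comm] at hl
    exact le_abs.1 hl
  rw [← ofReal_measureReal]
  refine ENNReal.ofReal_le_ofReal ?_
  calc _ ≤ _ := measureReal_mono hsubset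
    _ ≤ _ := measureReal_union_le _ _
    _ ≤ Real.exp (-(n * ε) ^ 2 / (2 * V)) + Real.exp (-(n * ε) ^ 2 / (2 * V)) :=
        add_le_add (hsub.measure_ge_le hnε) (hsub.neg.measure_ge_le hnε)
    _ ≤ _ := by linarith
end
end

section
/- Let μ be a probability measure on ℝ with infinite support and all moments finite, with Lebesgue decomposition dμ = w dx + dμ_sing, and let x* ∈ supp(μ) be such that: (i) x* is a Lebesgue point of μ in the sense that w(x*) > 0, μ_sing((x*−ε, x*+ε))/(2ε) → 0 as ε → 0⁺, and (1/(2ε)) ∫_{x*−ε}^{x*+ε} |w(x) − w(x*)| dx → 0 as ε → 0⁺; (ii) uniformly for a, b in compact subsets of ℝ, K_n( x* + a/K̃_n(x*,x*), x* + b/K̃_n(x*,x*) ) / K_n(x*,x*) → sin(π(b−a))/(π(b−a)) as n → ∞. Then μ satisfies the Nevai condition at x*: for every continuous compactly supported f : ℝ → ℝ, ∫ (f(y) − f(x*)) K_n(x*,y)²/K_n(x*,x*) dμ(y) → 0 as n → ∞. -/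
open MeasureTheory ProbabilityTheory Filter Topology

noncomputable section

theorem norm_fourierCoeffOn_exp_sq (x : ℝ) (n : ℤ) :
    ‖fourierCoeffOn zero_lt_one (fun t : ℝ => Complex.exp (Complex.I * ((2 * Real.pi * x * t : ℝ) : ℂ))) n‖ ^ 2
      = Real.sinc (Real.pi * (x - n)) ^ 2 := by
  rw [fourierCoeffOn_eq_integral]
  have h1 : ∀ t : ℝ, fourier (-n) (t : AddCircle ((1 : ℝ) - 0)) •
      Complex.exp (Complex.I * ((2 * Real.pi * x * t : ℝ) : ℂ))
      = Complex.exp ((Complex.I * ((2 * Real.pi * (x - n) : ℝ) : ℂ)) * t) := by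
    intro t
    rw [fourier_coe_apply, smul_eq_mul, ← Complex.exp_add]
    congr 1
    push_cast
    ring
  simp_rw [h1]
  rcases eq_or_ne (x - n) 0 with h | h
  · simp [h]
  · rw [integral_exp_mul_complex (mul_ne_zero Complex.I_ne_zero
      (Complex.ofReal_ne_zero.mpr (mul_ne_zero (mul_ne_zero two_ne_zero Real.pi_ne_zero) h)))]
    rw [Real.sinc_of_ne_zero (mul_ne_zero Real.pi_ne_zero h)]
    simp only [Complex.ofReal_one, mul_one, Complex.ofReal_zero, mul_zero, Complex.exp_zero,
      norm_smul, norm_div, Complex.norm_exp_I_mul_ofReal_sub_one, norm_mul, Complex.norm_I,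
      Complex.norm_real, Real.norm_eq_abs]
    rw [show 2 * Real.pi * (x - n) / 2 = Real.pi * (x - n) by ring]
    rw [← sq_abs (Real.sin _ / _), abs_div, abs_mul]
    have : |x - n| ≠ 0 := abs_ne_zero.mpr h
    have := Real.pi_ne_zero
    norm_num
    field_simp

theorem hasSum_sinc_sq (x : ℝ) :
    HasSum (fun n : ℤ => Real.sinc (Real.pi * (x - n)) ^ 2) 1 := by
  have h := hasSum_sq_fourierCoeffOn (a := 0) (b := 1)
    (f := fun t : ℝ => Complex.exp (Complex.I * ((2 * Real.pi * x * t : ℝ) : ℂ))) zero_lt_one ?_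
  · simp_rw [norm_fourierCoeffOn_exp_sq] at h
    convert h using 1
    simp [Complex.norm_exp]
  · refine MemLp.of_bound (by fun_prop) 1 (ae_of_all _ fun t => ?_)
    simp [Complex.norm_exp]

theorem lintegral_sinc_sq :
    ∫⁻ x : ℝ, ENNReal.ofReal (Real.sinc (Real.pi * x) ^ 2) = 1 := by
  rw [← setLIntegral_univ, ← iUnion_Ioc_intCast ℝ,
    lintegral_iUnion (fun _ => measurableSet_Ioc) (Set.pairwise_disjoint_Ioc_intCast ℝ)]
  have h1 : ∀ n : ℤ, ∫⁻ x in Set.Ioc (n : ℝ) (n + 1), ENNReal.ofReal (Real.sinc (Real.pi * x) ^ 2)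
      = ∫⁻ x in Set.Ioc (0 : ℝ) 1, ENNReal.ofReal (Real.sinc (Real.pi * (x + n)) ^ 2) := by
    intro n
    rw [← (measurePreserving_add_right volume (n : ℝ)).setLIntegral_comp_preimage_emb
      (measurableEmbedding_addRight _)]
    simp
  simp_rw [h1]
  rw [← lintegral_tsum (fun n => by
    have := Real.measurable_sinc
    fun_prop)]
  have h2 : ∀ x : ℝ, ∑' n : ℤ, ENNReal.ofReal (Real.sinc (Real.pi * (x + n)) ^ 2) = 1 := by
    intro x
    have := (Equiv.neg ℤ).hasSum_iff.mpr (hasSum_sinc_sq x)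
    simp only [Function.comp_def, Equiv.neg_apply, Int.cast_neg, sub_neg_eq_add] at this
    rw [← ENNReal.ofReal_tsum_of_nonneg (fun _ => sq_nonneg _) this.summable, this.tsum_eq,
      ENNReal.ofReal_one]
  simp [h2]

theorem integrable_sinc_sq : Integrable fun x : ℝ => Real.sinc (Real.pi * x) ^ 2 := by
  refine ⟨by have := Real.measurable_sinc; fun_prop, ?_⟩
  rw [hasFiniteIntegral_iff_ofReal (ae_of_all _ fun _ => sq_nonneg _), lintegral_sinc_sq]
  exact ENNReal.one_lt_top

theorem integral_sinc_sq : ∫ x : ℝ, Real.sinc (Real.pi * x) ^ 2 = 1 := by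
  rw [integral_eq_lintegral_of_nonneg_ae (ae_of_all _ fun _ => sq_nonneg _)
    integrable_sinc_sq.aestronglyMeasurable, lintegral_sinc_sq, ENNReal.toReal_one]

theorem tendsto_intervalIntegral_sinc_sq :
    Tendsto (fun A : ℝ => ∫ x in -A..A, Real.sinc (Real.pi * x) ^ 2) atTop (𝓝 1) := by
  rw [← integral_sinc_sq]
  exact intervalIntegral_tendsto_integral integrable_sinc_sq tendsto_neg_atTop_atBot tendsto_id

/-- A sequence of probability densities concentrating at `c` tests bounded continuous functions
at `c`. -/
theorem tendsto_integral_sub_mul_of_concentrates {μ : Measure ℝ} {h : ℕ → ℝ → ℝ} {c : ℝ}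
    (h_nonneg : ∀ n y, 0 ≤ h n y) (h_int : ∀ n, Integrable (h n) μ)
    (h_one : ∀ᶠ n in atTop, ∫ y, h n y ∂μ = 1)
    (h_conc : ∀ r > 0, ∀ ε > 0, ∀ᶠ n in atTop,
      1 - ε ≤ ∫ y in Set.Ioo (c - r) (c + r), h n y ∂μ)
    {f : ℝ → ℝ} (hf : Continuous f) {M : ℝ} (hM : ∀ y, |f y| ≤ M) :
    Tendsto (fun n => ∫ y, (f y - f c) * h n y ∂μ) atTop (𝓝 0) := by
  have hM0 : 0 ≤ M := (abs_nonneg _).trans (hM c)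
  rw [Metric.tendsto_nhds]
  intro ε hε
  obtain ⟨r, hr, hfr⟩ := Metric.continuous_iff.mp hf c (ε / 4) (by positivity)
  filter_upwards [h_one, h_conc r hr (ε / (4 * (2 * M + 1))) (by positivity)] with n hn1 hn2
  set I := Set.Ioo (c - r) (c + r)
  have hI : MeasurableSet I := measurableSet_Ioo
  have hbound : ∀ y, |(f y - f c) * h n y| ≤
      ε / 4 * h n y + 2 * M * (h n y - I.indicator (h n) y) := by
    intro y
    rw [abs_mul, abs_of_nonneg (h_nonneg n y)]
    by_cases hy : y ∈ I
    · rw [Set.indicator_of_mem hy, sub_self, mul_zero, add_zero]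
      refine mul_le_mul_of_nonneg_right ?_ (h_nonneg n y)
      have := hfr y (by rw [Real.dist_eq, abs_lt]; constructor <;> linarith [hy.1, hy.2])
      exact this.le
    · rw [Set.indicator_of_notMem hy, sub_zero, ← add_mul]
      refine mul_le_mul_of_nonneg_right ?_ (h_nonneg n y)
      have := abs_sub (f y) (f c)
      linarith [hM y, hM c]
  have hi1 : Integrable (fun y => ε / 4 * h n y) μ := (h_int n).const_mul _
  have hi2 : Integrable (fun y => h n y - I.indicator (h n) y) μ :=
    (h_int n).sub ((h_int n).indicator hI)
  have hle : |∫ y, (f y - f c) * h n y ∂μ| ≤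
      ∫ y, (ε / 4 * h n y + 2 * M * (h n y - I.indicator (h n) y)) ∂μ := by
    rw [← Real.norm_eq_abs]
    exact norm_integral_le_of_norm_le (hi1.add (hi2.const_mul _)) (ae_of_all _ hbound)
  rw [integral_add hi1 (hi2.const_mul _), integral_const_mul, integral_const_mul,
    integral_sub (h_int n) ((h_int n).indicator hI), integral_indicator hI, hn1] at hle
  rw [Real.dist_eq, sub_zero]
  have h3 : 2 * M * (1 - ∫ y in I, h n y ∂μ) ≤ 2 * M * (ε / (4 * (2 * M + 1))) :=
    mul_le_mul_of_nonneg_left (by linarith) (by positivity)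
  have h4 : 2 * M * (ε / (4 * (2 * M + 1))) ≤ ε / 4 := by
    rw [mul_div_assoc', div_le_div_iff₀ (by positivity) (by positivity)]
    nlinarith
  linarith

/-- If `g` is close to the squared rescaled sine kernel near `c`, then its `μ`-mass near `c` is
bounded below in terms of the squared sine kernel and the oscillation of the density of `μ`. -/
theorem le_mul_setIntegral_of_near_sinc_sq {μ : Measure ℝ} [IsFiniteMeasure μ] {g : ℝ → ℝ}
    (hg : Continuous g) (hg0 : ∀ y, 0 ≤ g y) {c A δ k w₀ : ℝ} (hA : 0 < A) (hk : 0 < k)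
    (hw₀ : 0 < w₀) (hδ : δ ≤ 1)
    (hnear : ∀ y ∈ Set.Ioo (c - A / (w₀ * k)) (c + A / (w₀ * k)),
      |g y - Real.sinc (Real.pi * (w₀ * k * (y - c))) ^ 2| ≤ δ) :
    (∫ x in -A..A, Real.sinc (Real.pi * x) ^ 2) - 2 * A * δ
      - 2 * k * (∫ y in Set.Ioo (c - A / (w₀ * k)) (c + A / (w₀ * k)),
          |(μ.rnDeriv volume y).toReal - w₀|)
      ≤ k * ∫ y in Set.Ioo (c - A / (w₀ * k)) (c + A / (w₀ * k)), g y ∂μ := by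
  set T := w₀ * k with hT
  have hT0 : 0 < T := mul_pos hw₀ hk
  set w : ℝ → ℝ := fun y => (μ.rnDeriv volume y).toReal
  set I := Set.Ioo (c - A / T) (c + A / T)
  have hI : MeasurableSet I := measurableSet_Ioo
  have hAT : 0 < A / T := div_pos hA hT0
  have hwint : Integrable w volume := Measure.integrable_toReal_rnDeriv
  have hgI : ∀ ν : Measure ℝ, IsLocallyFiniteMeasure ν → IntegrableOn g I ν := fun ν _ =>
    (hg.continuousOn.integrableOn_Icc (a := c - A / T) (b := c + A / T)).mono_set
      Set.Ioo_subset_Icc_self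
  have hs : Continuous fun y => Real.sinc (Real.pi * (T * (y - c))) ^ 2 := by
    have := Real.continuous_sinc
    fun_prop
  have hsI : IntegrableOn (fun y => Real.sinc (Real.pi * (T * (y - c))) ^ 2) I volume :=
    (hs.continuousOn.integrableOn_Icc (a := c - A / T) (b := c + A / T)).mono_set
      Set.Ioo_subset_Icc_self
  have hg2 : ∀ y ∈ I, g y ≤ 2 := by
    intro y hy
    have h1 := (abs_le.mp (hnear y hy)).2
    have h2 := (sq_le_one_iff_abs_le_one _).mpr
      (Real.abs_sinc_le_one (Real.pi * (T * (y - c))))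
    linarith
  have hwI : IntegrableOn (fun y => |w y - w₀|) I volume :=
    (hwint.integrableOn.sub (integrableOn_const (by simp [I]))).abs
  have hwgI : IntegrableOn (fun y => w y * g y) I volume := by
    refine Integrable.mul_bdd (c := 2) hwint.integrableOn hg.aestronglyMeasurable ?_
    filter_upwards [ae_restrict_mem hI] with y hy
    rw [Real.norm_eq_abs, abs_of_nonneg (hg0 y)]
    exact hg2 y hy
  have step1 : ∫ y in I, w y * g y ≤ ∫ y in I, g y ∂μ := by
    have h1 : ∫ y in I, w y * g y = ∫ y in I, g y ∂(volume.withDensity (μ.rnDeriv volume)) := by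
      rw [restrict_withDensity hI, integral_withDensity_eq_integral_toReal_smul
        (Measure.measurable_rnDeriv _ _) (ae_restrict_of_ae (Measure.rnDeriv_lt_top _ _))]
      rfl
    rw [h1]
    exact integral_mono_measure
      (Measure.restrict_mono le_rfl (Measure.withDensity_rnDeriv_le μ volume))
      (ae_of_all _ hg0) (hgI μ inferInstance)
  have step2 : w₀ * (∫ y in I, Real.sinc (Real.pi * (T * (y - c))) ^ 2) - w₀ * (2 * (A / T) * δ)
      - 2 * ∫ y in I, |w y - w₀| ≤ ∫ y in I, w y * g y := by
    have hvol : ∫ _ in I, δ = 2 * (A / T) * δ := by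
      rw [setIntegral_const, Real.volume_real_Ioo_of_le (by linarith), smul_eq_mul]
      ring
    have hc : IntegrableOn (fun _ : ℝ => δ) I volume := integrableOn_const (by simp [I])
    rw [← hvol, ← integral_const_mul, ← integral_const_mul, ← integral_const_mul,
      ← integral_sub (hsI.const_mul _) (hc.const_mul _),
      ← integral_sub (by exact (hsI.const_mul _).sub (hc.const_mul _)) (hwI.const_mul _)]
    refine setIntegral_mono_on (((hsI.const_mul _).sub (hc.const_mul _)).sub (hwI.const_mul _))
      hwgI hI fun y hy => ?_
    have h1 := (abs_le.mp (hnear y hy)).1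
    have h2 : w₀ * (Real.sinc (Real.pi * (T * (y - c))) ^ 2 - δ) ≤ w₀ * g y :=
      mul_le_mul_of_nonneg_left (by linarith) hw₀.le
    have h3 : (w₀ - w y) * g y ≤ |w y - w₀| * 2 :=
      mul_le_mul ((le_abs_self _).trans_eq (abs_sub_comm _ _)) (hg2 y hy) (hg0 y) (abs_nonneg _)
    linarith
  have step3 : T * ∫ y in I, Real.sinc (Real.pi * (T * (y - c))) ^ 2 =
      ∫ x in -A..A, Real.sinc (Real.pi * x) ^ 2 := by
    rw [← integral_Ioc_eq_integral_Ioo, ← intervalIntegral.integral_of_le (by linarith)]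
    have h1 := intervalIntegral.mul_integral_comp_mul_sub
      (f := fun x => Real.sinc (Real.pi * x) ^ 2) (a := c - A / T) (b := c + A / T) T (T * c)
    simp_rw [← mul_sub] at h1
    rw [h1]
    congr 1 <;> (field_simp; ring)
  have step4 := mul_le_mul_of_nonneg_left (step2.trans step1) hk.le
  refine le_trans (le_of_eq ?_) step4
  rw [← step3, hT]
  field_simp
  rfl

theorem integrable_eval_of_hasAllMoments {μ : Measure ℝ} (hmom : HasAllMoments μ)
    (q : Polynomial ℝ) : Integrable (fun x => q.eval x) μ := by
  simp_rw [Polynomial.eval_eq_sum_range]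
  exact integrable_finsetSum _ fun i _ => (hmom i).const_mul _

theorem continuous_CDKernel (p : ℕ → Polynomial ℝ) (n : ℕ) (x : ℝ) :
    Continuous (CDKernel p n x) := by
  unfold CDKernel
  fun_prop

theorem CDKernel_sq_eq (p : ℕ → Polynomial ℝ) (n : ℕ) (x y : ℝ) :
    CDKernel p n x y ^ 2 = ∑ i ∈ Finset.range n, ∑ j ∈ Finset.range n,
      ((p i).eval x * (p j).eval x) * (p i * p j).eval y := by
  rw [sq, CDKernel, Finset.sum_mul_sum]
  refine Finset.sum_congr rfl fun i _ => Finset.sum_congr rfl fun j _ => ?_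
  rw [Polynomial.eval_mul]
  ring

theorem integrable_CDKernel_sq {μ : Measure ℝ} (hmom : HasAllMoments μ)
    (p : ℕ → Polynomial ℝ) (n : ℕ) (x : ℝ) : Integrable (fun y => CDKernel p n x y ^ 2) μ := by
  simp_rw [CDKernel_sq_eq]
  exact integrable_finsetSum _ fun i _ => integrable_finsetSum _ fun j _ =>
    (integrable_eval_of_hasAllMoments hmom _).const_mul _

/-- The reproducing property of the Christoffel–Darboux kernel on the diagonal. -/
theorem integral_CDKernel_sq {μ : Measure ℝ} (hmom : HasAllMoments μ)
    {p : ℕ → Polynomial ℝ} (hp : IsOrthonormalPolys μ p) (n : ℕ) (x : ℝ) :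
    ∫ y, CDKernel p n x y ^ 2 ∂μ = CDKernel p n x x := by
  simp_rw [CDKernel_sq_eq]
  rw [integral_finsetSum _ fun i _ => integrable_finsetSum _ fun j _ =>
    (integrable_eval_of_hasAllMoments hmom _).const_mul _]
  refine Finset.sum_congr rfl fun i hi => ?_
  rw [integral_finsetSum _ fun j _ => (integrable_eval_of_hasAllMoments hmom _).const_mul _]
  simp_rw [integral_const_mul, Polynomial.eval_mul, hp.2.2]
  simp [Finset.mem_range.mp hi]

theorem CDKernel_self_mono (p : ℕ → Polynomial ℝ) (x : ℝ) :
    Monotone fun n => CDKernel p n x x := fun _ _ hmn =>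
  Finset.sum_le_sum_of_subset_of_nonneg (Finset.range_subset_range.mpr hmn)
    fun _ _ _ => mul_self_nonneg _

theorem sq_eval_le_CDKernel_self (p : ℕ → Polynomial ℝ) {j n : ℕ} (hj : j < n) (x : ℝ) :
    (p j).eval x ^ 2 ≤ CDKernel p n x x := by
  rw [sq]
  exact Finset.single_le_sum (f := fun j => (p j).eval x * (p j).eval x)
    (fun _ _ => mul_self_nonneg _) (Finset.mem_range.mpr hj)

theorem CDKernel_self_pos {μ : Measure ℝ} {p : ℕ → Polynomial ℝ} (hp : IsOrthonormalPolys μ p)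
    {n : ℕ} (hn : 0 < n) (x : ℝ) : 0 < CDKernel p n x x := by
  refine lt_of_lt_of_le (sq_pos_of_ne_zero ?_) (sq_eval_le_CDKernel_self p hn x)
  have h0 : (p 0).degree = 0 := hp.1 0
  rw [Polynomial.eq_C_of_degree_eq_zero h0, Polynomial.eval_C]
  exact Polynomial.coeff_ne_zero_of_eq_degree h0

/-- If the diagonal kernel at `x` and at the points `x + a / (w₀ K_n(x,x))` are asymptotically
equal, then the diagonal kernel at `x` is unbounded. -/
theorem tendsto_CDKernel_self_atTop {μ : Measure ℝ} {p : ℕ → Polynomial ℝ}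
    (hp : IsOrthonormalPolys μ p) {x w₀ : ℝ} (hw₀ : 0 < w₀)
    (hdiag : ∀ a : ℝ, Tendsto (fun n =>
      CDKernel p n (x + a / (w₀ * CDKernel p n x x)) (x + a / (w₀ * CDKernel p n x x)) /
        CDKernel p n x x) atTop (𝓝 1)) :
    Tendsto (fun n => CDKernel p n x x) atTop atTop := by
  rcases tendsto_atTop_of_monotone (CDKernel_self_mono p x) with h | ⟨k, hk⟩
  · exact h
  exfalso
  have hkpos : 0 < k := (CDKernel_self_pos hp one_pos x).trans_le
    ((CDKernel_self_mono p x).ge_of_tendsto hk 1)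
  have hbdd : ∀ a : ℝ, (p 1).eval (x + a / (w₀ * k)) ^ 2 ≤ k := by
    intro a
    have h1 : Tendsto (fun n => (p 1).eval (x + a / (w₀ * CDKernel p n x x)) ^ 2) atTop
        (𝓝 ((p 1).eval (x + a / (w₀ * k)) ^ 2)) := by
      refine (((p 1).continuous.tendsto _).comp ?_).pow 2
      exact (tendsto_const_nhds.div (hk.const_mul w₀) (mul_pos hw₀ hkpos).ne').const_add x
    have h2 := (hdiag a).mul hk
    rw [one_mul] at h2
    refine le_of_tendsto_of_tendsto h1 h2 ?_
    filter_upwards [eventually_gt_atTop 1] with n hn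
    rw [div_mul_cancel₀ _ (CDKernel_self_pos hp (by omega) x).ne']
    exact sq_eval_le_CDKernel_self p hn _
  have hp1 : 0 < (p 1).degree := by rw [hp.1 1]; exact_mod_cast one_pos
  have hinf := (p 1).tendsto_atTop_of_leadingCoeff_nonneg hp1 (hp.2.1 1).le
  obtain ⟨y, hy⟩ := (hinf.eventually_gt_atTop (k + 1)).exists
  have h3 := hbdd ((y - x) * (w₀ * k))
  rw [mul_div_cancel_right₀ _ (mul_pos hw₀ hkpos).ne', add_sub_cancel] at h3
  nlinarith

theorem sineKernel_eq_sinc (t : ℝ) : sineKernel t = Real.sinc (Real.pi * t) := by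
  simp [sineKernel, Real.sinc, Real.pi_ne_zero]

theorem abs_sq_sub_sq_le_of_abs_sub_le {u s δ : ℝ} (hs : |s| ≤ 1) (hδ : δ ≤ 1)
    (h : |u - s| ≤ δ / 3) : |u ^ 2 - s ^ 2| ≤ δ := by
  have h0 : 0 ≤ δ / 3 := (abs_nonneg _).trans h
  have h1 : |u + s| ≤ 3 := by
    rw [abs_le] at *
    constructor <;> linarith [hs.1, hs.2, h.1, h.2]
  rw [sq_sub_sq, abs_mul]
  calc |u + s| * |u - s| ≤ 3 * (δ / 3) := mul_le_mul h1 h (abs_nonneg _) (by norm_num)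
    _ = δ := by ring

/-- **Universality implies the Nevai condition** (Theorem 5.6): let `μ` be a probability
measure on `ℝ` with infinite support and all moments finite, `dμ = w dx + dμ_sing`, and
let `x* ∈ supp(μ)` be a Lebesgue point of `μ` (with `w(x*) > 0`) at which sine kernel
universality holds uniformly on compacts. Then `μ` satisfies the Nevai condition at
`x*`. -/
theorem universality_implies_Nevai
    (μ : Measure ℝ) (hprob : IsProbabilityMeasure μ)
    (hinf : InfiniteSupport μ) (hmom : HasAllMoments μ)
    (p : ℕ → Polynomial ℝ) (hp : IsOrthonormalPolys μ p)
    (xs : ℝ) (hxs : xs ∈ measSupport μ)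
    (hw : 0 < ((μ.rnDeriv volume) xs).toReal)
    (hsing : Tendsto
      (fun ε : ℝ => (μ.singularPart volume (Set.Ioo (xs - ε) (xs + ε))).toReal / (2 * ε))
      (𝓝[>] 0) (𝓝 0))
    (hleb : Tendsto
      (fun ε : ℝ => (1 / (2 * ε)) * ∫ x in Set.Ioo (xs - ε) (xs + ε),
        |((μ.rnDeriv volume) x).toReal - ((μ.rnDeriv volume) xs).toReal|)
      (𝓝[>] 0) (𝓝 0))
    (huniv : ∀ S : Set ℝ, IsCompact S →
      TendstoUniformlyOn
        (fun (n : ℕ) (q : ℝ × ℝ) =>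
          CDKernel p n (xs + q.1 / tildeK μ (CDKernel p n) xs xs)
              (xs + q.2 / tildeK μ (CDKernel p n) xs xs) / CDKernel p n xs xs)
        (fun q => sineKernel (q.2 - q.1)) atTop (S ×ˢ S)) :
    ∀ f : ℝ → ℝ, Continuous f → HasCompactSupport f →
      Tendsto (fun n : ℕ =>
          ∫ y, (f y - f xs) * CDKernel p n xs y ^ 2 / CDKernel p n xs xs ∂μ)
        atTop (𝓝 0) := by
  have hT : ∀ n, tildeK μ (CDKernel p n) xs xs =
      (μ.rnDeriv volume xs).toReal * CDKernel p n xs xs := fun n => by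
    rw [tildeK, Real.mul_self_sqrt hw.le]
  simp_rw [hT] at huniv
  set w₀ := (μ.rnDeriv volume xs).toReal
  set k : ℕ → ℝ := fun n => CDKernel p n xs xs with hk
  have hk_pos : ∀ {n : ℕ}, 0 < n → 0 < k n := fun hn => CDKernel_self_pos hp hn xs
  have hk_top : Tendsto k atTop atTop := by
    refine tendsto_CDKernel_self_atTop hp hw fun a => ?_
    have := (huniv {a} isCompact_singleton).tendsto_at (x := (a, a)) (by simp)
    simpa [sineKernel] using this
  intro f hf hfc
  obtain ⟨M, hM⟩ := hf.bounded_above_of_compact_support hfc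
  simp_rw [mul_div_assoc]
  have hint : ∀ n, Integrable (fun y => CDKernel p n xs y ^ 2 / CDKernel p n xs xs) μ := fun n =>
    (integrable_CDKernel_sq hmom p n xs).div_const _
  have hnonneg : ∀ n y, 0 ≤ CDKernel p n xs y ^ 2 / CDKernel p n xs xs := fun n y =>
    div_nonneg (sq_nonneg _) (Finset.sum_nonneg fun _ _ => mul_self_nonneg _)
  refine tendsto_integral_sub_mul_of_concentrates hnonneg hint ?_ ?_ hf hM
  · filter_upwards [eventually_gt_atTop 0] with n hn
    rw [integral_div, integral_CDKernel_sq hmom hp, div_self (hk_pos hn).ne']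
  intro r hr ε hε
  obtain ⟨A, hAsinc, hA⟩ := ((tendsto_intervalIntegral_sinc_sq.eventually_const_le
    (show 1 - ε / 3 < 1 by linarith)).and (eventually_gt_atTop 0)).exists
  obtain ⟨δ, hδ0, hδ1, hδA⟩ : ∃ δ : ℝ, 0 < δ ∧ δ ≤ 1 ∧ 2 * A * δ ≤ ε / 3 := by
    refine ⟨min 1 (ε / (6 * A)), by positivity, min_le_left _ _, ?_⟩
    calc 2 * A * min 1 (ε / (6 * A)) ≤ 2 * A * (ε / (6 * A)) := by gcongr; exact min_le_right _ _
      _ = ε / 3 := by field_simp; norm_num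
  have hT_top : Tendsto (fun n => w₀ * k n) atTop atTop := hk_top.const_mul_atTop hw
  have hrad : Tendsto (fun n => A / (w₀ * k n)) atTop (𝓝[>] 0) := by
    refine tendsto_nhdsWithin_iff.mpr ⟨hT_top.const_div_atTop A, ?_⟩
    filter_upwards [hT_top.eventually_gt_atTop 0] with n hn
    exact div_pos hA hn
  have hosc := ((hleb.comp hrad).const_mul (4 * A / w₀))
  rw [mul_zero] at hosc
  have hKunif := Metric.tendstoUniformlyOn_iff.mp (huniv (Set.Icc (-A) A) isCompact_Icc)
    (δ / 3) (by positivity)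
  filter_upwards [hosc.eventually_le_const (show 0 < ε / 3 by positivity), hKunif,
    eventually_gt_atTop 0,
    (hrad.mono_right nhdsWithin_le_nhds).eventually_le_const hr] with n hosc_n hK hn hrn
  have hkn : 0 < k n := hk_pos hn
  have hTn : 0 < w₀ * k n := mul_pos hw hkn
  have hmass := le_mul_setIntegral_of_near_sinc_sq (μ := μ) (c := xs) (A := A) (δ := δ)
    (k := k n) (w₀ := w₀) (g := fun y => (CDKernel p n xs y / k n) ^ 2)
    (((continuous_CDKernel p n xs).div_const _).pow 2) (fun _ => sq_nonneg _) hA hkn hw hδ1 ?_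
  · have h1 : 2 * k n * (∫ y in Set.Ioo (xs - A / (w₀ * k n)) (xs + A / (w₀ * k n)),
        |(μ.rnDeriv volume y).toReal - w₀|) ≤ ε / 3 := by
      refine le_trans (le_of_eq ?_) hosc_n
      simp only [Function.comp_apply]
      field_simp
      ring
    have h2 : k n * (∫ y in Set.Ioo (xs - A / (w₀ * k n)) (xs + A / (w₀ * k n)),
        (CDKernel p n xs y / k n) ^ 2 ∂μ) =
        ∫ y in Set.Ioo (xs - A / (w₀ * k n)) (xs + A / (w₀ * k n)),
          CDKernel p n xs y ^ 2 / CDKernel p n xs xs ∂μ := by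
      rw [← integral_const_mul]
      refine integral_congr_ae (ae_of_all _ fun y => ?_)
      change k n * (CDKernel p n xs y / k n) ^ 2 = CDKernel p n xs y ^ 2 / k n
      field_simp
    have h3 : (∫ y in Set.Ioo (xs - A / (w₀ * k n)) (xs + A / (w₀ * k n)),
          CDKernel p n xs y ^ 2 / CDKernel p n xs xs ∂μ) ≤
        ∫ y in Set.Ioo (xs - r) (xs + r), CDKernel p n xs y ^ 2 / CDKernel p n xs xs ∂μ :=
      setIntegral_mono_set (hint n).integrableOn (ae_of_all _ (hnonneg n))
        (Set.Ioo_subset_Ioo (by linarith) (by linarith)).eventuallyLE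
    linarith
  · intro y hy
    have hb : w₀ * k n * (y - xs) ∈ Set.Icc (-A) A := by
      have e : A = w₀ * k n * (A / (w₀ * k n)) := by field_simp
      constructor
      · calc -A = w₀ * k n * (-(A / (w₀ * k n))) := by rw [mul_neg, ← e]
          _ ≤ _ := mul_le_mul_of_nonneg_left (by linarith [hy.1]) hTn.le
      · calc w₀ * k n * (y - xs) ≤ w₀ * k n * (A / (w₀ * k n)) :=
              mul_le_mul_of_nonneg_left (by linarith [hy.2]) hTn.le
          _ = A := e.symm
    have h1 := hK (0, w₀ * k n * (y - xs)) ⟨⟨by linarith, hA.le⟩, hb⟩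
    rw [Real.dist_eq, abs_sub_comm, sineKernel_eq_sinc] at h1
    simp only [zero_div, add_zero, sub_zero] at h1
    rw [mul_div_cancel_left₀ _ hTn.ne', add_sub_cancel] at h1
    exact abs_sq_sub_sq_le_of_abs_sub_le (Real.abs_sinc_le_one _) hδ1 h1.le
end
end
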